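/- arXiv:0906.2101 — 2 statements merged into one kernel-verified Lean document; each statement's English description precedes it below -/
import Mathlib

section
/- The function r ↦ Y(r) = 2(1 − 2r·daw(r)) is Lebesgue integrable on ℝ and ∫_ℝ Y(r) dr = 0. Consequently, for every c > 0, ∫_ℝ Y(r/c) dr = 0. -/
open MeasureTheory Filter Topology

noncomputable section

/-- The Dawson integral `daw(r) = e^{-r²} ∫₀^r e^{x²} dx`. -/
def daw (r : ℝ) : ℝ := Real.exp (-r ^ 2) * ∫ x in (0:ℝ)..r, Real.exp (x ^ 2)

/-- `Y(r) := 2·daw'(r) = 2(1 - 2r·daw(r))`. -/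
def Yf (r : ℝ) : ℝ := 2 * (1 - 2 * r * daw r)

lemma hasDerivAt_integral_exp_sq (r : ℝ) :
    HasDerivAt (fun r : ℝ => ∫ x in (0:ℝ)..r, Real.exp (x ^ 2)) (Real.exp (r ^ 2)) r := by
  have hc : Continuous fun x : ℝ => Real.exp (x ^ 2) := by fun_prop
  exact hc.integral_hasStrictDerivAt 0 r |>.hasDerivAt

lemma hasDerivAt_daw (r : ℝ) : HasDerivAt daw (1 - 2 * r * daw r) r := by
  have h1 : HasDerivAt (fun r : ℝ => Real.exp (-r ^ 2)) (Real.exp (-r ^ 2) * (-(2 * r))) r := by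
    simpa using ((hasDerivAt_pow 2 r).neg).exp
  refine (h1.mul (hasDerivAt_integral_exp_sq r)).congr_deriv ?_
  have h2 : Real.exp (-r ^ 2) * Real.exp (r ^ 2) = 1 := by
    rw [← Real.exp_add]; simp
  rw [h2, daw]
  ring

lemma continuous_daw : Continuous daw :=
  continuous_iff_continuousAt.2 fun r => (hasDerivAt_daw r).continuousAt

lemma daw_zero : daw 0 = 0 := by simp [daw]

/-- Comparison principle: `r * u r ≥ 0` whenever `u 0 = 0` and `u' + 2 r u ≥ 0`. -/
lemma mul_self_nonneg_of_deriv_add_nonneg {u u' : ℝ → ℝ} (hu : ∀ r, HasDerivAt u (u' r) r)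
    (h0 : u 0 = 0) (h : ∀ r, 0 ≤ u' r + 2 * r * u r) (r : ℝ) : 0 ≤ r * u r := by
  have hd : ∀ r, HasDerivAt (fun r : ℝ => Real.exp (r ^ 2) * u r)
      (Real.exp (r ^ 2) * (u' r + 2 * r * u r)) r := fun r => by
    have h1 : HasDerivAt (fun r : ℝ => Real.exp (r ^ 2)) (Real.exp (r ^ 2) * (2 * r)) r := by
      simpa using (hasDerivAt_pow 2 r).exp
    exact (h1.mul (hu r)).congr_deriv (by ring)
  have hm : Monotone fun r : ℝ => Real.exp (r ^ 2) * u r :=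
    monotone_of_hasDerivAt_nonneg hd fun r => mul_nonneg (Real.exp_pos _).le (h r)
  have he := Real.exp_pos (r ^ 2)
  rcases le_total 0 r with hr | hr
  · have := hm hr
    simp only [h0, mul_zero] at this
    exact mul_nonneg hr (nonneg_of_mul_nonneg_right this he)
  · have := hm hr
    simp only [h0, mul_zero] at this
    exact mul_nonneg_of_nonpos_of_nonpos hr (by nlinarith)

lemma sq_div_le_mul_daw (r : ℝ) : r ^ 2 / (1 + 2 * r ^ 2) ≤ r * daw r := by
  have hD : ∀ r : ℝ, 1 + 2 * r ^ 2 ≠ 0 := fun r => by positivity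
  have hg : ∀ r : ℝ, HasDerivAt (fun r : ℝ => r / (1 + 2 * r ^ 2))
      ((1 * (1 + 2 * r ^ 2) - r * (2 * (2 * r))) / (1 + 2 * r ^ 2) ^ 2) r := fun r => by
    have h1 : HasDerivAt (fun r : ℝ => 1 + 2 * r ^ 2) (2 * (2 * r)) r := by
      simpa using ((hasDerivAt_pow 2 r).const_mul 2).const_add 1
    exact (hasDerivAt_id r).div h1 (hD r)
  have key := mul_self_nonneg_of_deriv_add_nonneg (fun r => (hasDerivAt_daw r).sub (hg r))
    (by simp [daw_zero]) (fun r => by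
      have : 0 ≤ 4 * r ^ 2 / (1 + 2 * r ^ 2) ^ 2 := by positivity
      refine this.trans_eq ?_
      have := hD r
      simp only [Pi.sub_apply]
      field_simp
      ring) r
  simp only [Pi.sub_apply, mul_sub] at key
  have e : r * (r / (1 + 2 * r ^ 2)) = r ^ 2 / (1 + 2 * r ^ 2) := by ring
  linarith

lemma mul_daw_le (r : ℝ) : r * daw r ≤ (r ^ 4 + 2 * r ^ 2) / (2 * r ^ 4 + 2) := by
  have hD : ∀ r : ℝ, 2 * r ^ 4 + 2 ≠ 0 := fun r => by positivity
  have hg : ∀ r : ℝ, HasDerivAt (fun r : ℝ => (r ^ 3 + 2 * r) / (2 * r ^ 4 + 2))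
      (((3 * r ^ 2 + 2) * (2 * r ^ 4 + 2) - (r ^ 3 + 2 * r) * (2 * (4 * r ^ 3))) /
        (2 * r ^ 4 + 2) ^ 2) r := fun r => by
    have h1 : HasDerivAt (fun r : ℝ => 2 * r ^ 4 + 2) (2 * (4 * r ^ 3)) r := by
      simpa using ((hasDerivAt_pow 4 r).const_mul 2).add_const 2
    have h2 : HasDerivAt (fun r : ℝ => r ^ 3 + 2 * r) (3 * r ^ 2 + 2) r := by
      simpa using (hasDerivAt_pow 3 r).fun_add ((hasDerivAt_id r).const_mul 2)
    exact h2.div h1 (hD r)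
  have key := mul_self_nonneg_of_deriv_add_nonneg (fun r => (hg r).sub (hasDerivAt_daw r))
    (by simp [daw_zero]) (fun r => by
      have : 0 ≤ r ^ 2 * (6 * (r ^ 2 - 4 / 3) ^ 2 + 10 / 3) / (2 * r ^ 4 + 2) ^ 2 := by positivity
      refine this.trans_eq ?_
      have := hD r
      simp only [Pi.sub_apply]
      field_simp
      ring) r
  simp only [Pi.sub_apply, mul_sub] at key
  have e : r * ((r ^ 3 + 2 * r) / (2 * r ^ 4 + 2)) = (r ^ 4 + 2 * r ^ 2) / (2 * r ^ 4 + 2) := by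
    ring
  linarith

lemma abs_Yf_le (r : ℝ) : |Yf r| ≤ 6 * (1 + r ^ 2)⁻¹ := by
  have h1 := sq_div_le_mul_daw r
  have h2 := mul_daw_le r
  have h3 : 1 / 2 - 3 / 2 * (1 + r ^ 2)⁻¹ ≤ r ^ 2 / (1 + 2 * r ^ 2) := by
    rw [← sub_nonneg]
    have : 0 ≤ (5 * r ^ 2 + 2) / (2 * (1 + r ^ 2) * (1 + 2 * r ^ 2)) := by positivity
    refine this.trans_eq ?_
    field_simp
    ring
  have h4 : (r ^ 4 + 2 * r ^ 2) / (2 * r ^ 4 + 2) ≤ 1 / 2 + 3 / 2 * (1 + r ^ 2)⁻¹ := by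
    rw [← sub_nonneg]
    have : 0 ≤ ((r ^ 2 - 1 / 2) ^ 2 + 15 / 4) / (2 * (1 + r ^ 2) * (r ^ 4 + 1)) := by positivity
    refine this.trans_eq ?_
    field_simp
    ring
  rw [abs_le, Yf]
  constructor <;> linarith

lemma integrable_Yf : Integrable Yf := by
  have hc : Continuous Yf := by
    have := continuous_daw
    unfold Yf
    fun_prop
  exact (integrable_inv_one_add_sq.const_mul 6).mono' hc.aestronglyMeasurable
    (ae_of_all _ abs_Yf_le)

lemma abs_daw_le (r : ℝ) (hr : r ≠ 0) : |daw r| ≤ 2 * |r⁻¹| := by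
  have h : |Yf r| ≤ 6 := (abs_Yf_le r).trans <| by
    have : (1 + r ^ 2)⁻¹ ≤ 1 := inv_le_one_of_one_le₀ (by nlinarith)
    linarith
  rw [abs_le, Yf] at h
  have h' : |r * daw r| ≤ 2 := abs_le.2 ⟨by linarith, by linarith⟩
  calc |daw r| = |r * daw r| * |r⁻¹| := by rw [← abs_mul]; field_simp
    _ ≤ 2 * |r⁻¹| := by gcongr

lemma tendsto_daw_of_tendsto_inv {l : Filter ℝ} (hl : Tendsto (fun r : ℝ => r⁻¹) l (𝓝 0))
    (h0 : ∀ᶠ r in l, r ≠ 0) : Tendsto daw l (𝓝 0) := by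
  refine squeeze_zero_norm' (h0.mono abs_daw_le) ?_
  simpa using hl.abs.const_mul 2

/-- `Y` is Lebesgue integrable on `ℝ`, `∫ Y = 0`, and consequently `∫ Y(r/c) dr = 0`
for every `c > 0`. -/
theorem Yf_integrable_integral_zero :
    Integrable Yf ∧ (∫ r : ℝ, Yf r) = 0 ∧ ∀ c : ℝ, 0 < c → (∫ r : ℝ, Yf (r / c)) = 0 := by
  have h0 : ∫ r : ℝ, Yf r = 0 := by
    have := integral_of_hasDerivAt_of_tendsto (fun r => (hasDerivAt_daw r).const_mul 2)
      integrable_Yf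
      ((tendsto_daw_of_tendsto_inv tendsto_inv_atBot_zero (eventually_ne_atBot 0)).const_mul 2)
      ((tendsto_daw_of_tendsto_inv tendsto_inv_atTop_zero (eventually_ne_atTop 0)).const_mul 2)
    simpa [Yf] using this
  refine ⟨integrable_Yf, h0, fun c _ => ?_⟩
  rw [Measure.integral_comp_div, h0, smul_zero]

end
end

section
/- For every p ∈ ℕ and every r ∈ ℝ, the (2p+1)-th derivative of Y satisfies Y^{(2p+1)}(r) = (−1)^{p+1} · 2^p · Σ_{k=0}^∞ [(−1)^k (k+p+1)! / (2^k (2k+1)!)] · H_{2k+1}(r), the series converging for all r. -/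
open MeasureTheory Filter Topology

noncomputable section

/-- The physicists' Hermite polynomials:
`H₀ = 1`, `H₁(x) = 2x`, `H_{n+1}(x) = 2x·H_n(x) - 2n·H_{n-1}(x)`. -/
def hermiteH : ℕ → ℝ → ℝ
  | 0 => fun _ => 1
  | 1 => fun x => 2 * x
  | (n + 2) => fun x => 2 * x * hermiteH (n + 1) x - 2 * (n + 1) * hermiteH n x

/-- The `n`-th derivative at `0` of `z ↦ exp (a z + b z²)`, given by its recurrence. -/
def quadExpCoeff (a b : ℝ) : ℕ → ℝ
  | 0 => 1
  | 1 => a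
  | (n + 2) => a * quadExpCoeff a b (n + 1) + 2 * b * (n + 1) * quadExpCoeff a b n

lemma hermiteH_eq_quadExpCoeff (r : ℝ) : ∀ n, hermiteH n r = quadExpCoeff (2 * r) (-1) n
  | 0 => rfl
  | 1 => rfl
  | (n + 2) => by
    simp only [hermiteH, quadExpCoeff, hermiteH_eq_quadExpCoeff r (n + 1),
      hermiteH_eq_quadExpCoeff r n]
    ring

lemma abs_quadExpCoeff_le (a b : ℝ) : ∀ n, |quadExpCoeff a b n| ≤ quadExpCoeff |a| |b| n
  | 0 => by simp [quadExpCoeff]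
  | 1 => by simp [quadExpCoeff]
  | (n + 2) => by
    rw [quadExpCoeff, quadExpCoeff]
    refine (abs_add_le _ _).trans ?_
    have hn : |(n : ℝ) + 1| = n + 1 := abs_of_nonneg (by positivity)
    simp only [abs_mul, hn, Nat.abs_ofNat]
    gcongr
    · exact abs_quadExpCoeff_le a b (n + 1)
    · exact abs_quadExpCoeff_le a b n

lemma iteratedDeriv_quadExp_succ_succ (a b : ℂ) (n : ℕ) :
    iteratedDeriv (n + 2) (fun z : ℂ => Complex.exp (a * z + b * z ^ 2)) = fun z =>
      (a + 2 * b * z) * iteratedDeriv (n + 1) (fun z : ℂ => Complex.exp (a * z + b * z ^ 2)) z +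
        2 * b * (n + 1) * iteratedDeriv n (fun z : ℂ => Complex.exp (a * z + b * z ^ 2)) z := by
  set f : ℂ → ℂ := fun z => Complex.exp (a * z + b * z ^ 2) with hf
  have hsm (m : ℕ) : ContDiff ℂ (m + 1) f := by fun_prop
  have hstep (m : ℕ) (z : ℂ) :
      HasDerivAt (iteratedDeriv m f) (iteratedDeriv (m + 1) f z) z := by
    rw [iteratedDeriv_succ]
    exact ((hsm m).differentiable_iteratedDeriv m (by exact_mod_cast m.lt_succ_self) z).hasDerivAt
  have hlin (z : ℂ) : HasDerivAt (fun z : ℂ => a + 2 * b * z) (2 * b) z := by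
    simpa using ((hasDerivAt_id z).const_mul (2 * b)).const_add a
  have hfirst : iteratedDeriv 1 f = fun z => (a + 2 * b * z) * f z := by
    funext z
    rw [iteratedDeriv_one]
    have h := (((hasDerivAt_id z).const_mul a).add (((hasDerivAt_id z).pow 2).const_mul b)).cexp
    refine h.deriv.trans ?_
    simp [hf]
    ring
  induction n with
  | zero =>
    funext z
    rw [iteratedDeriv_succ, zero_add, hfirst]
    have h0 := hstep 0 z
    rw [zero_add, iteratedDeriv_zero, hfirst] at h0
    refine ((hlin z).mul h0).deriv.trans ?_
    simp
    ring
  | succ n ih =>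
    funext z
    rw [iteratedDeriv_succ, ih]
    refine (((hlin z).mul (hstep (n + 1) z)).add
      ((hstep n z).const_mul (2 * b * ((n : ℂ) + 1)))).deriv.trans ?_
    simp only [ih]
    push_cast
    ring

lemma iteratedDeriv_quadExp_zero (a b : ℝ) : ∀ n,
    iteratedDeriv n (fun z : ℂ => Complex.exp (a * z + b * z ^ 2)) 0 = quadExpCoeff a b n
  | 0 => by simp [quadExpCoeff]
  | 1 => by
    have h := (((hasDerivAt_id (0 : ℂ)).const_mul (a : ℂ)).add
      (((hasDerivAt_id (0 : ℂ)).pow 2).const_mul (b : ℂ))).cexp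
    rw [iteratedDeriv_one]
    refine h.deriv.trans ?_
    simp [quadExpCoeff]
  | (n + 2) => by
    rw [iteratedDeriv_quadExp_succ_succ]
    simp only [iteratedDeriv_quadExp_zero a b (n + 1), iteratedDeriv_quadExp_zero a b n,
      quadExpCoeff]
    push_cast
    ring

lemma hasSum_quadExpCoeff (a b : ℝ) (z : ℂ) :
    HasSum (fun n : ℕ => (quadExpCoeff a b n : ℂ) * z ^ n / (n.factorial : ℂ))
      (Complex.exp (a * z + b * z ^ 2)) := by
  have hd : Differentiable ℂ (fun z : ℂ => Complex.exp (a * z + b * z ^ 2)) := by fun_prop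
  refine (Complex.hasSum_taylorSeries_of_entire hd 0 z).congr_fun ?_
  intro n
  simp only [iteratedDeriv_quadExp_zero, sub_zero, smul_eq_mul]
  ring

lemma hasSum_quadExpCoeff_real (a b x : ℝ) :
    HasSum (fun n : ℕ => quadExpCoeff a b n * x ^ n / (n.factorial : ℝ))
      (Real.exp (a * x + b * x ^ 2)) := by
  have h := hasSum_quadExpCoeff a b x
  exact_mod_cast h

/-- The imaginary part of the Hermite generating function on the imaginary axis. -/
lemma hasSum_hermiteH_im (r t : ℝ) :
    HasSum (fun n : ℕ => hermiteH n r * (t / 2) ^ n / (n.factorial : ℝ) * (Complex.I ^ n).im)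
      (Real.exp (t ^ 2 / 4) * Real.sin (r * t)) := by
  have h := Complex.hasSum_im (hasSum_quadExpCoeff (2 * r) (-1) (((t / 2 : ℝ) : ℂ) * Complex.I))
  convert h using 1
  · funext n
    rw [hermiteH_eq_quadExpCoeff, mul_pow, ← Complex.im_ofReal_mul]
    congr 1
    push_cast
    ring
  · have : ((2 * r : ℝ) : ℂ) * (((t / 2 : ℝ) : ℂ) * Complex.I) +
        ((-1 : ℝ) : ℂ) * (((t / 2 : ℝ) : ℂ) * Complex.I) ^ 2 =
        ((t ^ 2 / 4 : ℝ) : ℂ) + ((r * t : ℝ) : ℂ) * Complex.I := by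
      rw [mul_pow, Complex.I_sq]
      push_cast
      ring
    rw [this, Complex.exp_add, ← Complex.ofReal_exp, Complex.im_ofReal_mul,
      Complex.exp_ofReal_mul_I_im]

lemma integrableOn_pow_mul_exp_neg_mul_sq (n : ℕ) {b : ℝ} (hb : 0 < b) :
    IntegrableOn (fun t : ℝ => t ^ n * Real.exp (-b * t ^ 2)) (Set.Ioi 0) := by
  have h := integrableOn_rpow_mul_exp_neg_mul_sq hb (s := n)
    (by have : (0 : ℝ) ≤ n := n.cast_nonneg
        linarith)
  simpa only [Real.rpow_natCast] using h

lemma integral_odd_pow_mul_exp_neg_half_sq (m : ℕ) :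
    ∫ t in Set.Ioi (0 : ℝ), t ^ (2 * m + 1) * Real.exp (-(1 / 2) * t ^ 2) =
      2 ^ m * (m.factorial : ℝ) := by
  have hm : (-1 : ℝ) < ((2 * m + 1 : ℕ) : ℝ) := by
    have : (0 : ℝ) ≤ ((2 * m + 1 : ℕ) : ℝ) := Nat.cast_nonneg _
    linarith
  have h := integral_rpow_mul_exp_neg_mul_rpow (p := 2) two_pos hm
    (show (0 : ℝ) < 1 / 2 by norm_num)
  have hexp : (((2 * m + 1 : ℕ) : ℝ) + 1) / 2 = (m : ℝ) + 1 := by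
    push_cast
    ring
  rw [neg_div, hexp, Real.Gamma_nat_eq_factorial] at h
  simp only [Real.rpow_natCast, Real.rpow_two] at h
  rw [h, one_div, Real.rpow_neg (by norm_num), Real.inv_rpow (by norm_num), inv_inv]
  have : (2 : ℝ) ^ ((m : ℝ) + 1) = 2 ^ (m + 1) := by exact_mod_cast Real.rpow_natCast 2 (m + 1)
  rw [this, pow_succ]
  ring

/-- The Gaussian cosine moment `∫₀^∞ tⁿ e^{-t²/4} cos(rt + φ) dt`. -/
def gaussCos (n : ℕ) (φ r : ℝ) : ℝ :=
  ∫ t in Set.Ioi (0 : ℝ), t ^ n * Real.exp (-(1 / 4) * t ^ 2) * Real.cos (r * t + φ)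

lemma integrableOn_gaussCos (n : ℕ) (φ r : ℝ) :
    IntegrableOn (fun t : ℝ => t ^ n * Real.exp (-(1 / 4) * t ^ 2) * Real.cos (r * t + φ))
      (Set.Ioi 0) := by
  refine Integrable.mono' (integrableOn_pow_mul_exp_neg_mul_sq n (b := 1 / 4) (by norm_num))
    (by fun_prop) ?_
  filter_upwards [ae_restrict_mem measurableSet_Ioi] with t ht
  have ht' : (0 : ℝ) < t := ht
  rw [norm_mul, Real.norm_of_nonneg (by positivity)]
  exact mul_le_of_le_one_right (by positivity) (Real.abs_cos_le_one _)

lemma hasDerivAt_gaussCos (n : ℕ) (φ r : ℝ) :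
    HasDerivAt (gaussCos n φ) (gaussCos (n + 1) (φ + Real.pi / 2) r) r := by
  refine (hasDerivAt_integral_of_dominated_loc_of_deriv_le (s := Set.univ)
    (F := fun r t => t ^ n * Real.exp (-(1 / 4) * t ^ 2) * Real.cos (r * t + φ))
    (F' := fun r t =>
      t ^ (n + 1) * Real.exp (-(1 / 4) * t ^ 2) * Real.cos (r * t + (φ + Real.pi / 2)))
    (bound := fun t => t ^ (n + 1) * Real.exp (-(1 / 4) * t ^ 2)) univ_mem ?_
    (integrableOn_gaussCos n φ r) ?_ ?_
    (integrableOn_pow_mul_exp_neg_mul_sq (n + 1) (by norm_num)) ?_).2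
  · exact Eventually.of_forall fun x => (integrableOn_gaussCos n φ x).aestronglyMeasurable
  · exact (integrableOn_gaussCos (n + 1) _ r).aestronglyMeasurable
  · filter_upwards [ae_restrict_mem measurableSet_Ioi] with t ht x _
    have ht' : (0 : ℝ) < t := ht
    rw [norm_mul, Real.norm_of_nonneg (by positivity)]
    exact mul_le_of_le_one_right (by positivity) (Real.abs_cos_le_one _)
  · refine Eventually.of_forall fun t x _ => ?_
    have h := ((((hasDerivAt_id x).mul_const t).add_const φ).cos).const_mul
      (t ^ n * Real.exp (-(1 / 4) * t ^ 2))
    refine h.congr_deriv ?_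
    rw [← add_assoc, Real.cos_add_pi_div_two]
    simp only [id]
    ring

lemma iteratedDeriv_gaussCos (n : ℕ) (φ : ℝ) (m : ℕ) :
    iteratedDeriv m (gaussCos n φ) = gaussCos (n + m) (φ + m * (Real.pi / 2)) := by
  induction m with
  | zero => simp
  | succ m ih =>
    funext r
    rw [iteratedDeriv_succ, ih, (hasDerivAt_gaussCos _ _ r).deriv]
    congr 1
    push_cast
    ring

lemma gaussCos_one_zero (r : ℝ) :
    gaussCos 1 0 r = 2 - 2 * r * gaussCos 0 (-(Real.pi / 2)) r := by
  have hderiv (t : ℝ) : HasDerivAt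
      (fun t : ℝ => -2 * (Real.exp (-(1 / 4) * t ^ 2) * Real.cos (r * t)))
      (t ^ 1 * Real.exp (-(1 / 4) * t ^ 2) * Real.cos (r * t + 0) + 2 * r *
        (t ^ 0 * Real.exp (-(1 / 4) * t ^ 2) * Real.cos (r * t + -(Real.pi / 2)))) t := by
    have h := (((((hasDerivAt_id t).pow 2).const_mul (-(1 / 4) : ℝ)).exp).mul
      (((hasDerivAt_id t).const_mul r).cos)).const_mul (-2 : ℝ)
    refine h.congr_deriv ?_
    rw [← sub_eq_add_neg, Real.cos_sub_pi_div_two]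
    simp
    ring
  have hlim : Tendsto (fun t : ℝ => -2 * (Real.exp (-(1 / 4) * t ^ 2) * Real.cos (r * t)))
      atTop (𝓝 0) := by
    have hexp : Tendsto (fun t : ℝ => Real.exp (-(1 / 4) * t ^ 2)) atTop (𝓝 0) :=
      Real.tendsto_exp_atBot.comp
        ((tendsto_pow_atTop two_ne_zero).const_mul_atTop_of_neg (by norm_num))
    have h := (hexp.zero_mul_isBoundedUnder_le (g := fun t => Real.cos (r * t))
      (isBoundedUnder_of ⟨1, fun t => Real.abs_cos_le_one _⟩)).const_mul (-2 : ℝ)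
    simpa using h
  have hint := (integrableOn_gaussCos 0 (-(Real.pi / 2)) r).const_mul (2 * r)
  have h := integral_Ioi_of_hasDerivAt_of_tendsto' (a := 0) (fun t _ => hderiv t)
    ((integrableOn_gaussCos 1 0 r).add hint) hlim
  rw [integral_add (integrableOn_gaussCos 1 0 r) hint, integral_const_mul] at h
  change gaussCos 1 0 r + 2 * r * gaussCos 0 (-(Real.pi / 2)) r = _ at h
  norm_num at h
  linarith

lemma gaussCos_zero_eq_two_mul_daw (r : ℝ) : gaussCos 0 (-(Real.pi / 2)) r = 2 * daw r := by
  have hG (x : ℝ) : HasDerivAt (fun x => Real.exp (x ^ 2) * gaussCos 0 (-(Real.pi / 2)) x)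
      (2 * Real.exp (x ^ 2)) x := by
    have h := (((hasDerivAt_id x).pow 2).exp).mul (hasDerivAt_gaussCos 0 (-(Real.pi / 2)) x)
    refine h.congr_deriv ?_
    rw [neg_add_cancel, zero_add, gaussCos_one_zero]
    simp
    ring
  have h := intervalIntegral.integral_eq_sub_of_hasDerivAt (a := 0) (b := r) (fun x _ => hG x)
    (Continuous.intervalIntegrable (by fun_prop) _ _)
  have h0 : gaussCos 0 (-(Real.pi / 2)) 0 = 0 := by simp [gaussCos]
  rw [h0, intervalIntegral.integral_const_mul] at h
  rw [daw, mul_left_comm, h, mul_zero, sub_zero, ← mul_assoc, ← Real.exp_add]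
  simp

lemma Yf_eq_gaussCos : Yf = gaussCos 1 0 := by
  funext r
  rw [gaussCos_one_zero, gaussCos_zero_eq_two_mul_daw, Yf]
  ring

lemma iteratedDeriv_odd_Yf (p : ℕ) (r : ℝ) :
    iteratedDeriv (2 * p + 1) Yf r = (-1) ^ (p + 1) * ∫ t in Set.Ioi (0 : ℝ),
      t ^ (2 * p + 2) * Real.exp (-(1 / 4) * t ^ 2) * Real.sin (r * t) := by
  rw [Yf_eq_gaussCos, iteratedDeriv_gaussCos, gaussCos, ← integral_const_mul]
  congr 1
  funext t
  have : r * t + (0 + ((2 * p + 1 : ℕ) : ℝ) * (Real.pi / 2)) =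
      (r * t + Real.pi / 2) + p * Real.pi := by
    push_cast
    ring
  rw [this, Real.cos_add_nat_mul_pi, Real.cos_add_pi_div_two]
  ring

lemma integrableOn_pow_mul_exp_neg_half_sq_add_linear (n : ℕ) (c : ℝ) :
    IntegrableOn (fun t : ℝ => t ^ n * Real.exp (-(1 / 2) * t ^ 2) *
      Real.exp (2 * c * (t / 2) + 1 * (t / 2) ^ 2)) (Set.Ioi 0) := by
  refine Integrable.mono' ((integrableOn_pow_mul_exp_neg_mul_sq n (b := 1 / 8)
    (by norm_num)).const_mul (Real.exp (2 * c ^ 2))) (by fun_prop) ?_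
  filter_upwards [ae_restrict_mem measurableSet_Ioi] with t ht
  have ht' : (0 : ℝ) < t := ht
  rw [Real.norm_of_nonneg (by positivity), mul_assoc, ← Real.exp_add, mul_left_comm,
    ← Real.exp_add]
  refine mul_le_mul_of_nonneg_left (Real.exp_le_exp.mpr ?_) (by positivity)
  nlinarith [sq_nonneg (t - 4 * c)]

lemma hasSum_integral_hermiteH (n : ℕ) (r : ℝ) :
    HasSum (fun k : ℕ => ∫ t in Set.Ioi (0 : ℝ), t ^ n * Real.exp (-(1 / 2) * t ^ 2) *
        (hermiteH k r * (t / 2) ^ k / (k.factorial : ℝ) * (Complex.I ^ k).im))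
      (∫ t in Set.Ioi (0 : ℝ), t ^ n * Real.exp (-(1 / 4) * t ^ 2) * Real.sin (r * t)) := by
  have hbound (t : ℝ) := (hasSum_quadExpCoeff_real (2 * |r|) 1 (t / 2)).mul_left
    (t ^ n * Real.exp (-(1 / 2) * t ^ 2))
  refine hasSum_integral_of_dominated_convergence
    (fun k t => t ^ n * Real.exp (-(1 / 2) * t ^ 2) *
      (quadExpCoeff (2 * |r|) 1 k * (t / 2) ^ k / (k.factorial : ℝ))) ?_ ?_ ?_ ?_ ?_
  · intro k
    fun_prop
  · intro k
    filter_upwards [ae_restrict_mem measurableSet_Ioi] with t ht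
    have ht' : (0 : ℝ) < t := ht
    rw [norm_mul, Real.norm_of_nonneg (by positivity : 0 ≤ t ^ n * Real.exp (-(1 / 2) * t ^ 2))]
    gcongr
    have hI : |(Complex.I ^ k).im| ≤ 1 := by
      simpa using Complex.abs_im_le_norm (Complex.I ^ k)
    have hH : |hermiteH k r| ≤ quadExpCoeff (2 * |r|) 1 k := by
      simpa [hermiteH_eq_quadExpCoeff, abs_mul] using abs_quadExpCoeff_le (2 * r) (-1) k
    rw [norm_mul, norm_div, norm_mul, Real.norm_of_nonneg (by positivity : 0 ≤ (t / 2) ^ k),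
      Real.norm_of_nonneg (by positivity : (0 : ℝ) ≤ k.factorial)]
    refine (mul_le_of_le_one_right (by positivity) hI).trans ?_
    gcongr
    exact hH
  · exact Eventually.of_forall fun t => (hbound t).summable
  · simp only [(hbound _).tsum_eq]
    exact integrableOn_pow_mul_exp_neg_half_sq_add_linear n |r|
  · refine Eventually.of_forall fun t => ?_
    convert! (hasSum_hermiteH_im r t).mul_left (t ^ n * Real.exp (-(1 / 2) * t ^ 2)) using 1
    have hsplit : Real.exp (-(1 / 4) * t ^ 2) =
        Real.exp (-(1 / 2) * t ^ 2) * Real.exp (t ^ 2 / 4) := by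
      rw [← Real.exp_add]
      congr 1
      ring
    rw [hsplit]
    ring

lemma im_I_pow_two_mul (k : ℕ) : (Complex.I ^ (2 * k)).im = 0 := by
  rw [pow_mul, Complex.I_sq]
  exact_mod_cast Complex.ofReal_im ((-1 : ℝ) ^ k)

lemma im_I_pow_two_mul_add_one (k : ℕ) : (Complex.I ^ (2 * k + 1)).im = (-1) ^ k := by
  rw [pow_succ, pow_mul, Complex.I_sq, Complex.mul_I_im]
  exact_mod_cast Complex.ofReal_re ((-1 : ℝ) ^ k)

/-- For all `p ∈ ℕ` and `r ∈ ℝ`: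
`Y^{(2p+1)}(r) = (-1)^{p+1} 2^p Σ_{k=0}^∞ (-1)^k (k+p+1)!/(2^k (2k+1)!) H_{2k+1}(r)`,
the series converging for all `r`. -/
theorem Yf_odd_deriv_hermite_series (p : ℕ) (r : ℝ) :
    HasSum
      (fun k : ℕ =>
        (-1 : ℝ) ^ (p + 1) * 2 ^ p *
          ((-1 : ℝ) ^ k * ((k + p + 1).factorial : ℝ) /
            (2 ^ k * ((2 * k + 1).factorial : ℝ))) *
          hermiteH (2 * k + 1) r)
      (iteratedDeriv (2 * p + 1) Yf r) := by
  rw [iteratedDeriv_odd_Yf]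
  have hinj : Function.Injective (fun k : ℕ => 2 * k + 1) := fun a b h => by
    simp only at h
    omega
  have hodd := (hinj.hasSum_iff (fun n hn => ?_)).mpr (hasSum_integral_hermiteH (2 * p + 2) r)
  · convert! hodd.mul_left ((-1 : ℝ) ^ (p + 1)) using 1
    funext k
    have hcoeff (t : ℝ) : t ^ (2 * p + 2) * Real.exp (-(1 / 2) * t ^ 2) *
        (hermiteH (2 * k + 1) r * (t / 2) ^ (2 * k + 1) / ((2 * k + 1).factorial : ℝ) *
          (Complex.I ^ (2 * k + 1)).im) =
        (-1) ^ k * hermiteH (2 * k + 1) r / (2 ^ (2 * k + 1) * ((2 * k + 1).factorial : ℝ)) *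
          (t ^ (2 * (k + p + 1) + 1) * Real.exp (-(1 / 2) * t ^ 2)) := by
      rw [im_I_pow_two_mul_add_one, div_pow]
      field_simp
      ring
    simp only [Function.comp_apply, hcoeff, integral_const_mul,
      integral_odd_pow_mul_exp_neg_half_sq]
    have h2 : (2 : ℝ) ^ (2 * k + 1) = 2 ^ k * 2 ^ k * 2 := by ring
    have h3 : (2 : ℝ) ^ (k + p + 1) = 2 ^ k * 2 ^ p * 2 := by ring
    rw [h2, h3]
    field_simp
  · obtain ⟨k, rfl | rfl⟩ := n.even_or_odd'
    · simp [im_I_pow_two_mul]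
    · exact absurd ⟨k, rfl⟩ hn

end
end
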